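/- Stability of the scheme (velocity estimate): assume the initial values satisfy hypothesis (H1): |u⁰_h| + |u¹_h| + k|∇_h p¹_h| ≤ C₀. Then there exists a constant C > 0 depending only on Ω, the mesh-regularity constant C_reg, Re, T, sup_{t∈[0,T]}|f(t)|_{L²} and C₀ (but not on h, k or N) such that for every m ∈ {2,…,N}: |u^m_h|² + k ∑_{n=2}^m ‖ũⁿ_h‖_h² ≤ C. -/

import Mathlib

open scoped RealInnerProductSpace
open MeasureTheory

attribute [local instance] Classical.propDecidable

noncomputable section

/-- The Euclidean plane. -/
abbrev E2 : Type := EuclideanSpace ℝ (Fin 2)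

/-- A nondegenerate (closed) triangle of the plane, given by its three
affinely independent vertices. -/
structure Tri : Type where
  vtx : Fin 3 → E2
  indep : AffineIndependent ℝ vtx

namespace Tri

/-- The triangle as a subset of the plane: the convex hull of its vertices. -/
def carrier (t : Tri) : Set E2 := convexHull ℝ (Set.range t.vtx)

/-- The area `|K|` of the triangle. -/
def area (t : Tri) : ℝ := (volume t.carrier).toReal

/-- The centroid of the triangle. -/
def centroid (t : Tri) : E2 := Finset.centroid ℝ Finset.univ t.vtx

/-- The triangle seen as a 2-simplex. -/
def simplex (t : Tri) : Affine.Simplex ℝ E2 2 := ⟨t.vtx, t.indep⟩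

/-- The circumcenter `x_K` of the triangle. -/
def ccenter (t : Tri) : E2 := t.simplex.circumcenter

/-- `σ` (an ordered pair of distinct points) is an edge of the triangle `t`:
both of its endpoints are vertices of `t`. -/
def hasEdge (t : Tri) (σ : E2 × E2) : Prop :=
  σ.1 ≠ σ.2 ∧ σ.1 ∈ Set.range t.vtx ∧ σ.2 ∈ Set.range t.vtx

end Tri

/-- The segment of an edge. -/
def eseg (σ : E2 × E2) : Set E2 := segment ℝ σ.1 σ.2

/-- The length `|σ|` of an edge. -/
def elen (σ : E2 × E2) : ℝ := dist σ.1 σ.2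

/-- The midpoint `x_σ` of an edge. -/
def emid (σ : E2 × E2) : E2 := midpoint ℝ σ.1 σ.2

/-- Rotation by `π/2` in the plane. -/
def perp (x : E2) : E2 := (EuclideanSpace.equiv (Fin 2) ℝ).symm ![-(x 1), x 0]

/-- The unit normal `n_{K,σ}` to the edge `σ`, pointing outward of the triangle `t`. -/
def Tri.nrm (t : Tri) (σ : E2 × E2) : E2 :=
  if 0 ≤ ⟪perp (σ.2 - σ.1), emid σ - t.centroid⟫
  then (elen σ)⁻¹ • perp (σ.2 - σ.1)
  else -((elen σ)⁻¹ • perp (σ.2 - σ.1))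

/-- An admissible triangulation `𝒯_h` of `Ω`, together with a registration of its
edges (each geometric edge is recorded once, with a chosen orientation) and a labelling
`K_σ`, `L_σ` of the triangle(s) adjacent to each edge.  All interior angles of all
triangles are `< π/2`. -/
structure Mesh (Ω : Set E2) : Type where
  tris : Finset Tri
  tris_nonempty : tris.Nonempty
  edges : Finset (E2 × E2)
  Kof : E2 × E2 → Tri
  Lof : E2 × E2 → Tri
  interior_disjoint : ∀ t₁ ∈ tris, ∀ t₂ ∈ tris, t₁ ≠ t₂ →
    interior t₁.carrier ∩ interior t₂.carrier = ∅
  union_eq : ⋃ t ∈ (tris : Set Tri), t.carrier = closure Ω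
  inter_structure : ∀ t₁ ∈ tris, ∀ t₂ ∈ tris, t₁ ≠ t₂ →
    t₁.carrier ∩ t₂.carrier = ∅
    ∨ (∃ a ∈ Set.range t₁.vtx ∩ Set.range t₂.vtx, t₁.carrier ∩ t₂.carrier = {a})
    ∨ (∃ σ, t₁.hasEdge σ ∧ t₂.hasEdge σ ∧ t₁.carrier ∩ t₂.carrier = eseg σ)
  angles_lt : ∀ t ∈ tris, ∀ i j l : Fin 3, i ≠ j → i ≠ l → j ≠ l →
    EuclideanGeometry.angle (t.vtx j) (t.vtx i) (t.vtx l) < Real.pi / 2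
  edges_ne : ∀ σ ∈ edges, σ.1 ≠ σ.2
  edges_cover : ∀ t ∈ tris, ∀ i j : Fin 3, i ≠ j →
    (t.vtx i, t.vtx j) ∈ edges ∨ (t.vtx j, t.vtx i) ∈ edges
  edges_sub : ∀ σ ∈ edges, ∃ t ∈ tris, t.hasEdge σ
  edges_orient : ∀ σ ∈ edges, Prod.swap σ ∉ edges
  edges_atMostTwo : ∀ σ ∈ edges, (tris.filter fun t => t.hasEdge σ).card ≤ 2
  Kof_mem : ∀ σ ∈ edges, Kof σ ∈ tris ∧ (Kof σ).hasEdge σ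
  Lof_mem : ∀ σ ∈ edges, (tris.filter fun t => t.hasEdge σ).card = 2 →
    Lof σ ∈ tris ∧ (Lof σ).hasEdge σ ∧ Lof σ ≠ Kof σ
  ext_frontier : ∀ σ ∈ edges, (tris.filter fun t => t.hasEdge σ).card = 1 →
    eseg σ ⊆ frontier Ω

namespace Mesh

variable {Ω : Set E2} (M : Mesh Ω)

/-- The interior edges `ℰ_h^int` (shared by exactly two triangles). -/
def intEdges : Finset (E2 × E2) :=
  M.edges.filter fun σ => (M.tris.filter fun t => t.hasEdge σ).card = 2

/-- The boundary edges `ℰ_h^ext`. -/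
def extEdges : Finset (E2 × E2) :=
  M.edges.filter fun σ => (M.tris.filter fun t => t.hasEdge σ).card = 1

/-- `d_σ`: distance between the circumcenters of the two triangles sharing `σ`
(interior edges), or from the circumcenter of `K_σ` to the midpoint of `σ`
(boundary edges). -/
def dOf (σ : E2 × E2) : ℝ :=
  if (M.tris.filter fun t => t.hasEdge σ).card = 2
  then dist (M.Kof σ).ccenter (M.Lof σ).ccenter
  else dist (M.Kof σ).ccenter (emid σ)

/-- `τ_σ = |σ| / d_σ`. -/
def tau (σ : E2 × E2) : ℝ := elen σ / M.dOf σ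

/-- The mesh size `h`: the largest diameter of a circumscribed circle. -/
def meshSize : ℝ := M.tris.sup' M.tris_nonempty fun t => 2 * t.simplex.circumradius

/-- Mesh regularity with constant `C_reg`: `d_σ ≥ C_reg |σ|` and `|σ| ≥ C_reg h`. -/
def Regular (Creg : ℝ) : Prop :=
  ∀ σ ∈ M.edges, Creg * elen σ ≤ M.dOf σ ∧ Creg * M.meshSize ≤ elen σ

/-- For `σ` an edge of `t`, the triangle on the other side of `σ`. -/
def other (t : Tri) (σ : E2 × E2) : Tri := if M.Kof σ = t then M.Lof σ else M.Kof σ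

/-- The `L²(Ω)` inner product of two piecewise constant (`P₀`) fields. -/
def l2P0 (v w : Tri → E2) : ℝ := ∑ t ∈ M.tris, t.area * ⟪v t, w t⟫

/-- The `L²(Ω)` norm of a `P₀` field. -/
def l2normP0 (v : Tri → E2) : ℝ := Real.sqrt (M.l2P0 v v)

/-- The discrete `H¹` norm `‖·‖_h` on `P₀`. -/
def normh (v : Tri → E2) : ℝ :=
  Real.sqrt (∑ σ ∈ M.intEdges, M.tau σ * ‖v (M.Lof σ) - v (M.Kof σ)‖ ^ 2
    + ∑ σ ∈ M.extEdges, M.tau σ * ‖v (M.Kof σ)‖ ^ 2)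

/-- A family of affine maps (one per triangle) is in `P₁^{nc}`: the two traces agree
at the midpoint of every interior edge. -/
def IsP1nc (q : Tri → (E2 →ᵃ[ℝ] ℝ)) : Prop :=
  ∀ σ ∈ M.intEdges, q (M.Kof σ) (emid σ) = q (M.Lof σ) (emid σ)

/-- Membership in `L²₀`: the piecewise affine function has zero mean on `Ω`. -/
def MeanZero (q : Tri → (E2 →ᵃ[ℝ] ℝ)) : Prop :=
  ∑ t ∈ M.tris, ∫ x in t.carrier, q t x = 0

/-- The `L²(Ω)` inner product of two piecewise affine functions. -/
def l2P1 (q r : Tri → (E2 →ᵃ[ℝ] ℝ)) : ℝ :=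
  ∑ t ∈ M.tris, ∫ x in t.carrier, q t x * r t x

/-- The `L²(Ω)` norm of a piecewise affine function. -/
def l2normP1 (q : Tri → (E2 →ᵃ[ℝ] ℝ)) : ℝ := Real.sqrt (M.l2P1 q q)

end Mesh

/-- The gradient (a constant vector) of an affine function on the plane. -/
def gradA (f : E2 →ᵃ[ℝ] ℝ) : E2 :=
  (InnerProductSpace.toDual ℝ E2).symm (LinearMap.toContinuousLinearMap f.linear)

/-- The discrete gradient `∇_h q` of a piecewise affine function: the piecewise
constant field equal on each triangle to the gradient of the affine piece. -/
def gradh (q : Tri → (E2 →ᵃ[ℝ] ℝ)) : Tri → E2 := fun t => gradA (q t)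

/-- The (constant) divergence of an affine vector field of the plane. -/
def divA (f : E2 →ᵃ[ℝ] E2) : ℝ := LinearMap.trace ℝ E2 f.linear

/-- The normal component `(u·n_{K,σ})_σ` of a piecewise affine field on the edge `σ`
of the triangle `t` (evaluated at the midpoint of `σ`). -/
def unrm (u : Tri → (E2 →ᵃ[ℝ] E2)) (t : Tri) (σ : E2 × E2) : ℝ :=
  ⟪u t (emid σ), t.nrm σ⟫

namespace Mesh

variable {Ω : Set E2} (M : Mesh Ω)

/-- The norm `‖q‖_{1,h} = (|q|² + |∇_h q|²)^{1/2}` on `P₁^{nc}`. -/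
def norm1h (q : Tri → (E2 →ᵃ[ℝ] ℝ)) : ℝ :=
  Real.sqrt ((M.l2normP1 q) ^ 2 + (M.l2normP0 (gradh q)) ^ 2)

/-- The prescribed value of `div_h v` at the midpoint of the edge `σ`. -/
def divhImage (v : Tri → E2) (σ : E2 × E2) : ℝ :=
  if (M.tris.filter fun t => t.hasEdge σ).card = 2 then
    (3 * elen σ / ((M.Kof σ).area + (M.Lof σ).area)) *
      ⟪v (M.Lof σ) - v (M.Kof σ), (M.Kof σ).nrm σ⟫
  else
    -((3 * elen σ / (M.Kof σ).area) * ⟪v (M.Kof σ), (M.Kof σ).nrm σ⟫)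

/-- `d = div_h v`: `d` is the element of `P₁^{nc}` taking the prescribed values at
the midpoints of the edges. -/
def IsDivh (v : Tri → E2) (d : Tri → (E2 →ᵃ[ℝ] ℝ)) : Prop :=
  M.IsP1nc d ∧
    ∀ t ∈ M.tris, ∀ σ ∈ M.edges, t.hasEdge σ → d t (emid σ) = M.divhImage v σ

/-- The discrete Laplacian `Δ̃_h` on `P₀`. -/
def laph (v : Tri → E2) : Tri → E2 := fun t =>
  (t.area)⁻¹ •
    ((∑ σ ∈ M.intEdges.filter fun σ => t.hasEdge σ, M.tau σ • (v (M.other t σ) - v t))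
      - ∑ σ ∈ M.extEdges.filter fun σ => t.hasEdge σ, M.tau σ • v t)

/-- The upwind convection operator `b̃_h(u_h, v_h) ∈ P₀`. -/
def btilde (u : Tri → (E2 →ᵃ[ℝ] E2)) (v : Tri → E2) : Tri → E2 := fun t =>
  (t.area)⁻¹ • ∑ σ ∈ M.intEdges.filter fun σ => t.hasEdge σ,
    elen σ • (max (unrm u t σ) 0 • v t + min (unrm u t σ) 0 • v (M.other t σ))

/-- The trilinear form `b_h(u_h, v_h, w_h)`. -/
def bh (u : Tri → (E2 →ᵃ[ℝ] E2)) (v w : Tri → E2) : ℝ :=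
  ∑ t ∈ M.tris, t.area * ⟪w t, M.btilde u v t⟫

/-- Membership in the lowest-order Raviart–Thomas space `RT₀`: the normal component is
constant on each edge of each triangle, matches across interior edges and vanishes on
boundary edges. -/
def IsRT0 (u : Tri → (E2 →ᵃ[ℝ] E2)) : Prop :=
  (∀ t ∈ M.tris, ∀ σ ∈ M.edges, t.hasEdge σ → ∀ x ∈ eseg σ,
      ⟪u t x, t.nrm σ⟫ = unrm u t σ)
  ∧ (∀ σ ∈ M.intEdges,
      ⟪u (M.Kof σ) (emid σ), (M.Kof σ).nrm σ⟫ =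
        ⟪u (M.Lof σ) (emid σ), (M.Kof σ).nrm σ⟫)
  ∧ (∀ σ ∈ M.extEdges, unrm u (M.Kof σ) σ = 0)

/-- Membership of a piecewise constant field in `P₀ ∩ RT₀`. -/
def IsRT0const (v : Tri → E2) : Prop :=
  (∀ σ ∈ M.intEdges, ⟪v (M.Lof σ) - v (M.Kof σ), (M.Kof σ).nrm σ⟫ = 0)
  ∧ ∀ σ ∈ M.extEdges, ⟪v (M.Kof σ), (M.Kof σ).nrm σ⟫ = 0

/-- The `L²(Ω)` norm of a piecewise affine vector field. -/
def l2normRT (u : Tri → (E2 →ᵃ[ℝ] E2)) : ℝ :=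
  Real.sqrt (∑ t ∈ M.tris, ∫ x in t.carrier, ‖u t x‖ ^ 2)

end Mesh

/-- The projection scheme of the paper: the BDF2 momentum step, the pressure projection
step and the velocity correction step, with time step `k = T/N`. -/
structure Scheme {Ω : Set E2} (M : Mesh Ω) : Type where
  Re : ℝ
  T : ℝ
  N : ℕ
  hRe : 0 < Re
  hT : 0 < T
  hN : 2 ≤ N
  k : ℝ
  hk : k = T / N
  fh : ℕ → Tri → E2
  u : ℕ → Tri → E2
  ut : ℕ → Tri → E2
  p : ℕ → Tri → (E2 →ᵃ[ℝ] ℝ)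
  hu0 : M.IsRT0const (u 0)
  hu1 : M.IsRT0const (u 1)
  hp : ∀ n, 1 ≤ n → n ≤ N → M.IsP1nc (p n) ∧ M.MeanZero (p n)
  mom : ∀ n, 1 ≤ n → n + 1 ≤ N → ∀ t ∈ M.tris,
    (2 * k)⁻¹ • ((3 : ℝ) • ut (n+1) t - (4 : ℝ) • u n t + u (n-1) t)
      - Re⁻¹ • M.laph (ut (n+1)) t
      + M.btilde (fun s => AffineMap.const ℝ E2 ((2 : ℝ) • u n s - u (n-1) s)) (ut (n+1)) t
      + gradh (p n) t
      = fh (n+1) t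
  proj : ∀ n, 1 ≤ n → n + 1 ≤ N → ∀ σ ∈ M.edges,
    M.divhImage (fun s => gradA (p (n+1) s - p n s)) σ =
      (3 / (2 * k)) * M.divhImage (ut (n+1)) σ
  corr : ∀ n, 1 ≤ n → n + 1 ≤ N → ∀ t ∈ M.tris,
    u (n+1) t = ut (n+1) t - (2 * k / 3) • gradA (p (n+1) t - p n t)


def cr (x y : E2) : ℝ := ⟪perp x, y⟫

lemma cr_eq (x y : E2) : cr x y = x 0 * y 1 - x 1 * y 0 := by
  simp [cr, perp, PiLp.inner_apply, Fin.sum_univ_two]; ring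

lemma perp0 (x : E2) : perp x 0 = -(x 1) := by simp [perp]
lemma perp1 (x : E2) : perp x 1 = x 0 := by simp [perp]

/-- positive barycentric combinations are interior -/
lemma interior_of_pos (v : Fin 3 → E2) (hv : AffineIndependent ℝ v) (w : Fin 3 → ℝ)
    (hw : ∀ i, 0 < w i) (h1 : ∑ i, w i = 1) :
    ∑ i, w i • v i ∈ interior (convexHull ℝ (Set.range v)) := by
  have htop : affineSpan ℝ (Set.range v) = ⊤ := by
    rw [hv.affineSpan_eq_top_iff_card_eq_finrank_add_one]; simp
  let b : AffineBasis (Fin 3) ℝ E2 := ⟨v, hv, htop⟩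
  have hb : (b : Fin 3 → E2) = v := rfl
  rw [← hb, AffineBasis.interior_convexHull]
  intro i
  have := b.coord_apply_combination_of_mem (Finset.mem_univ i) h1
  rw [Finset.affineCombination_eq_linear_combination _ _ _ h1] at this
  rw [this]; exact hw i

lemma Tri.area_pos (t : Tri) : 0 < t.area := by
  have hi := interior_of_pos t.vtx t.indep (fun _ => 1/3) (by intro; norm_num)
    (by simp)
  have hc : IsCompact t.carrier := (Set.finite_range _).isCompact_convexHull ℝ
  refine ENNReal.toReal_pos ?_ hc.measure_lt_top.ne
  exact (Measure.measure_pos_of_nonempty_interior _ ⟨_, hi⟩).ne'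

def stdv : Fin 3 → E2 := ![0, EuclideanSpace.single 0 1, EuclideanSpace.single 1 1]

def cstd : ℝ := (volume (convexHull ℝ (Set.range stdv))).toReal

def Tri.D (t : Tri) : ℝ := cr (t.vtx 1 - t.vtx 0) (t.vtx 2 - t.vtx 0)

lemma Tri.area_eq (t : Tri) : t.area = cstd * |t.D| := by
  let A : Matrix (Fin 2) (Fin 2) ℝ :=
    !![(t.vtx 1 - t.vtx 0) 0, (t.vtx 2 - t.vtx 0) 0; (t.vtx 1 - t.vtx 0) 1, (t.vtx 2 - t.vtx 0) 1]
  let bs := (EuclideanSpace.basisFun (Fin 2) ℝ).toBasis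
  let f : E2 →ₗ[ℝ] E2 := Matrix.toLin bs bs A
  have hdet : LinearMap.det f = t.D := by
    rw [LinearMap.det_toLin, Matrix.det_fin_two_of, Tri.D, cr_eq]; ring
  have hf0 : f (EuclideanSpace.single 0 1) = t.vtx 1 - t.vtx 0 := by
    have := Matrix.toLin_self bs bs A 0
    simp only [bs, OrthonormalBasis.coe_toBasis, EuclideanSpace.basisFun_apply] at this
    rw [show f = Matrix.toLin bs bs A from rfl, this]
    ext i; fin_cases i <;> simp [A, Fin.sum_univ_two]
  have hf1 : f (EuclideanSpace.single 1 1) = t.vtx 2 - t.vtx 0 := by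
    have := Matrix.toLin_self bs bs A 1
    simp only [bs, OrthonormalBasis.coe_toBasis, EuclideanSpace.basisFun_apply] at this
    rw [show f = Matrix.toLin bs bs A from rfl, this]
    ext i; fin_cases i <;> simp [A, Fin.sum_univ_two]
  have hr : Set.range t.vtx = (fun x => t.vtx 0 + x) '' (f '' Set.range stdv) := by
    rw [← Set.range_comp, ← Set.range_comp]
    congr 1
    funext i
    fin_cases i
    · simp [stdv]
    · simp [stdv, hf0]
    · simp [stdv, hf1]
  have hcar : t.carrier = (fun x => t.vtx 0 + x) '' (f '' convexHull ℝ (Set.range stdv)) := by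
    rw [Tri.carrier, hr, LinearMap.image_convexHull]
    have := (AffineEquiv.constVAdd ℝ E2 (t.vtx 0)).toAffineMap.image_convexHull (f '' Set.range stdv)
    simpa using this.symm
  rw [Tri.area, hcar, Set.image_add_left, measure_preimage_add, Measure.addHaar_image_linearMap,
    hdet, ENNReal.toReal_mul, ENNReal.toReal_ofReal (abs_nonneg _), cstd, mul_comm]

lemma Tri.D_ne (t : Tri) : t.D ≠ 0 := by
  intro h
  have := t.area_pos
  rw [t.area_eq, h] at this
  simp at this

/-- third vertex data for an edge -/
lemma Tri.edge_data (t : Tri) (σ : E2 × E2) (h : t.hasEdge σ) :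
    ∃ C : E2, AffineIndependent ℝ ![σ.1, σ.2, C] ∧ Set.range t.vtx = Set.range ![σ.1, σ.2, C] ∧
      t.centroid = (1/3 : ℝ) • (σ.1 + σ.2 + C) ∧ cr (σ.2 - σ.1) (C - σ.1) ≠ 0 := by
  obtain ⟨hne, ⟨i, hi⟩, ⟨j, hj⟩⟩ := h
  have hij : i ≠ j := by rintro rfl; exact hne (hi.symm.trans hj)
  obtain ⟨l, hl⟩ : ∃ l : Fin 3, l ≠ i ∧ l ≠ j :=
    Fin.exists_ne_and_ne_of_two_lt i j (by norm_num)
  let e : Fin 3 → Fin 3 := ![i, j, l]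
  have einj : Function.Injective e := by
    intro a b; fin_cases a <;> fin_cases b <;> simp [e, hij, hij.symm, hl.1, hl.2, hl.1.symm, hl.2.symm]
  have ebij : Function.Bijective e := Finite.injective_iff_bijective.mp einj
  have hv : ![σ.1, σ.2, t.vtx l] = t.vtx ∘ e := by
    funext a; fin_cases a <;> simp [e, hi, hj]
  have hind : AffineIndependent ℝ ![σ.1, σ.2, t.vtx l] := by
    rw [hv]; exact t.indep.comp_embedding ⟨e, einj⟩
  refine ⟨t.vtx l, hind, ?_, ?_, ?_⟩
  · rw [hv, ebij.surjective.range_comp]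
  · have hs : ∑ a, t.vtx a = σ.1 + σ.2 + t.vtx l := by
      rw [← Equiv.sum_comp (Equiv.ofBijective e ebij)]
      simp [Fin.sum_univ_three, e, hi, hj]
    rw [← hs, Tri.centroid, Finset.centroid_def,
      Finset.affineCombination_eq_linear_combination _ _ _
        (Finset.sum_centroidWeights_eq_one_of_nonempty ℝ _ Finset.univ_nonempty)]
    simp [Finset.smul_sum]
  · have := Tri.D_ne ⟨_, hind⟩
    simpa [Tri.D] using this

/-- `|σ| n` in terms of the third vertex -/
lemma Tri.nrm_eq (t : Tri) (σ : E2 × E2) (C : E2)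
    (hc : t.centroid = (1/3 : ℝ) • (σ.1 + σ.2 + C)) :
    (cr (σ.2 - σ.1) (C - σ.1) < 0 → t.nrm σ = (elen σ)⁻¹ • perp (σ.2 - σ.1)) ∧
    (0 < cr (σ.2 - σ.1) (C - σ.1) → t.nrm σ = -((elen σ)⁻¹ • perp (σ.2 - σ.1))) := by
  have key : ⟪perp (σ.2 - σ.1), emid σ - t.centroid⟫ = -(1/3) * cr (σ.2 - σ.1) (C - σ.1) := by
    change cr _ _ = _
    rw [cr_eq, cr_eq, hc, emid, midpoint_eq_smul_add]
    simp; ring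
  rw [Tri.nrm, key]
  constructor
  · intro h; rw [if_pos (by linarith)]
  · intro h; rw [if_neg (by linarith)]

lemma elen_pos (σ : E2 × E2) (h : σ.1 ≠ σ.2) : 0 < elen σ := dist_pos.mpr h

lemma Tri.nrm_swap (t : Tri) (σ : E2 × E2) (h : t.hasEdge σ) : t.nrm σ.swap = t.nrm σ := by
  obtain ⟨C, -, -, hc, hne⟩ := t.edge_data σ h
  have hsw : cr (σ.swap.2 - σ.swap.1) (C - σ.swap.1) = - cr (σ.2 - σ.1) (C - σ.1) := by
    simp [cr_eq]; ring
  have h1 := t.nrm_eq σ C hc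
  have h2 := t.nrm_eq σ.swap C (by rw [hc]; simp [add_comm])
  have hp : perp (σ.swap.2 - σ.swap.1) = - perp (σ.2 - σ.1) := by
    ext i; fin_cases i <;> simp [perp0, perp1]
  have hl : elen σ.swap = elen σ := by simp [elen, dist_comm]
  rw [hsw, hp, hl] at h2
  rcases lt_or_gt_of_ne hne with h | h
  · rw [h1.1 h, h2.2 (by linarith)]; simp
  · rw [h1.2 h, h2.1 (by linarith)]; simp

/-- The two triangles of an interior edge lie on opposite sides. -/
lemma nrm_opp (K L : Tri) (σ : E2 × E2) (hK : K.hasEdge σ) (hL : L.hasEdge σ)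
    (hd : interior K.carrier ∩ interior L.carrier = ∅) : L.nrm σ = - K.nrm σ := by
  obtain ⟨C, hCi, hCr, hc, hne⟩ := K.edge_data σ hK
  obtain ⟨C', hCi', hCr', hc', hne'⟩ := L.edge_data σ hL
  have h1 := K.nrm_eq σ C hc
  have h2 := L.nrm_eq σ C' hc'
  by_cases hs : 0 < cr (σ.2 - σ.1) (C - σ.1) * cr (σ.2 - σ.1) (C' - σ.1)
  · exfalso
    set d := cr (σ.2 - σ.1) (C - σ.1) with hdd
    set d' := cr (σ.2 - σ.1) (C' - σ.1) with hdd'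
    -- C = α A + β B + γ C'
    set γ := d / d' with hγ
    have hγ0 : 0 < γ := by
      have : γ = d * d' / (d' * d') := by rw [hγ]; field_simp
      rw [this]; exact div_pos hs (mul_self_pos.mpr hne')
    set β := cr (C - σ.1) (C' - σ.1) / d' with hβ
    set α := 1 - β - γ with hα
    have hC : C = α • σ.1 + β • σ.2 + γ • C' := by
      have e1 : γ * d' = d := by rw [hγ]; field_simp
      have e2 : β * d' = cr (C - σ.1) (C' - σ.1) := by rw [hβ]; field_simp
      have : d' • C = d' • (α • σ.1 + β • σ.2 + γ • C') := by
        have e3 : d' • (α • σ.1 + β • σ.2 + γ • C') =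
            (d' - cr (C - σ.1) (C' - σ.1) - d) • σ.1 + (cr (C - σ.1) (C' - σ.1)) • σ.2 + d • C' := by
          rw [← e1, ← e2, hα]; module
        rw [e3, hdd, hdd']
        ext i; fin_cases i <;> simp [cr_eq] <;> ring
      exact smul_right_injective E2 hne' this
    obtain ⟨ε, hε0, hε1, hεa, hεb⟩ : ∃ ε : ℝ, 0 < ε ∧ ε < 1 ∧ 0 < (1-ε)/2 + ε * α ∧
        0 < (1-ε)/2 + ε * β := by
      refine ⟨1 / (4 * (1 + |α| + |β|)), by positivity, ?_, ?_, ?_⟩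
      · rw [div_lt_one (by positivity)]; linarith [abs_nonneg α, abs_nonneg β]
      · have hp : 0 < 1 + |α| + |β| := by positivity
        have := neg_abs_le α
        have h0 := abs_nonneg β
        have h00 := abs_nonneg α
        field_simp
        nlinarith
      · have hp : 0 < 1 + |α| + |β| := by positivity
        have := neg_abs_le β
        have h0 := abs_nonneg β
        have h00 := abs_nonneg α
        field_simp
        nlinarith
    have m1 := interior_of_pos _ hCi ![(1-ε)/2, (1-ε)/2, ε]
      (by intro i; fin_cases i <;> simp <;> linarith) (by simp [Fin.sum_univ_three])
    have m2 := interior_of_pos _ hCi' ![(1-ε)/2 + ε * α, (1-ε)/2 + ε * β, ε * γ]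
      (by intro i; fin_cases i <;> simp [hε0, hγ0] <;> linarith)
      (by simp [Fin.sum_univ_three, hα]; ring)
    rw [← hCr] at m1
    rw [← hCr'] at m2
    simp only [Fin.sum_univ_three, Matrix.cons_val_zero, Matrix.cons_val_one, Matrix.cons_val] at m1 m2
    have heq : ((1-ε)/2) • σ.1 + ((1-ε)/2) • σ.2 + ε • C =
        ((1-ε)/2 + ε * α) • σ.1 + ((1-ε)/2 + ε * β) • σ.2 + (ε * γ) • C' := by
      rw [hC]; module
    rw [heq] at m1
    have : _ ∈ interior K.carrier ∩ interior L.carrier := ⟨m1, m2⟩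
    rw [hd] at this
    exact this
  · rcases lt_or_gt_of_ne hne with h | h <;> rcases lt_or_gt_of_ne hne' with h' | h'
    · exact absurd (mul_pos_of_neg_of_neg h h') hs
    · rw [h1.1 h, h2.2 h']
    · rw [h1.2 h, h2.1 h']; simp
    · exact absurd (mul_pos h h') hs

lemma Tri.centroid_eq (t : Tri) :
    t.centroid = (1/3 : ℝ) • (t.vtx 0 + t.vtx 1 + t.vtx 2) := by
  rw [Tri.centroid, Finset.centroid_def,
      Finset.affineCombination_eq_linear_combination _ _ _
        (Finset.sum_centroidWeights_eq_one_of_nonempty ℝ _ Finset.univ_nonempty)]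
  simp [Fin.sum_univ_three]

lemma Tri.nrm3 (t : Tri) : ∃ s : ℝ, |t.D| = -(s * t.D) ∧
    elen (t.vtx 0, t.vtx 1) • t.nrm (t.vtx 0, t.vtx 1) = s • perp (t.vtx 1 - t.vtx 0) ∧
    elen (t.vtx 1, t.vtx 2) • t.nrm (t.vtx 1, t.vtx 2) = s • perp (t.vtx 2 - t.vtx 1) ∧
    elen (t.vtx 2, t.vtx 0) • t.nrm (t.vtx 2, t.vtx 0) = s • perp (t.vtx 0 - t.vtx 2) := by
  have hinj := t.indep.injective
  have l01 := (elen_pos (t.vtx 0, t.vtx 1) (hinj.ne (by norm_num))).ne'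
  have l12 := (elen_pos (t.vtx 1, t.vtx 2) (hinj.ne (by decide))).ne'
  have l20 := (elen_pos (t.vtx 2, t.vtx 0) (hinj.ne (by decide))).ne'
  have n01 := t.nrm_eq (t.vtx 0, t.vtx 1) (t.vtx 2) t.centroid_eq
  have n12 := t.nrm_eq (t.vtx 1, t.vtx 2) (t.vtx 0)
    (by rw [t.centroid_eq]; congr 1; simp only; abel)
  have n20 := t.nrm_eq (t.vtx 2, t.vtx 0) (t.vtx 1)
    (by rw [t.centroid_eq]; congr 1; simp only; abel)
  have d01 : cr (t.vtx 1 - t.vtx 0) (t.vtx 2 - t.vtx 0) = t.D := rfl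
  have d12 : cr (t.vtx 2 - t.vtx 1) (t.vtx 0 - t.vtx 1) = t.D := by
    simp only [Tri.D, cr_eq, PiLp.sub_apply]; ring
  have d20 : cr (t.vtx 0 - t.vtx 2) (t.vtx 1 - t.vtx 2) = t.D := by
    simp only [Tri.D, cr_eq, PiLp.sub_apply]; ring
  simp only [d01, d12, d20] at n01 n12 n20
  rcases lt_or_gt_of_ne t.D_ne with h | h
  · refine ⟨1, by rw [abs_of_neg h]; ring, ?_, ?_, ?_⟩
    · rw [n01.1 h, smul_smul, mul_inv_cancel₀ l01]
    · rw [n12.1 h, smul_smul, mul_inv_cancel₀ l12]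
    · rw [n20.1 h, smul_smul, mul_inv_cancel₀ l20]
  · refine ⟨-1, by rw [abs_of_pos h]; ring, ?_, ?_, ?_⟩
    · rw [n01.2 h, smul_neg, smul_smul, mul_inv_cancel₀ l01, neg_smul]
    · rw [n12.2 h, smul_neg, smul_smul, mul_inv_cancel₀ l12, neg_smul]
    · rw [n20.2 h, smul_neg, smul_smul, mul_inv_cancel₀ l20, neg_smul]

lemma gradA_inner (q : E2 →ᵃ[ℝ] ℝ) (x : E2) : ⟪gradA q, x⟫ = q.linear x := by
  rw [gradA, InnerProductSpace.toDual_symm_apply]; rfl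

lemma affine_eval (q : E2 →ᵃ[ℝ] ℝ) (x : E2) : q x = ⟪gradA q, x⟫ + q 0 := by
  rw [gradA_inner]
  conv_lhs => rw [AffineMap.decomp q]
  simp

lemma gradA_sub (q r : E2 →ᵃ[ℝ] ℝ) : gradA (q - r) = gradA q - gradA r := by
  apply ext_inner_right ℝ
  intro x
  rw [inner_sub_left, gradA_inner, gradA_inner, gradA_inner]; simp

lemma Tri.green (t : Tri) (q : E2 →ᵃ[ℝ] ℝ) (w : E2) :
    t.area * ⟪w, gradA q⟫ = 2 * cstd *
      (q (emid (t.vtx 0, t.vtx 1)) * (elen (t.vtx 0, t.vtx 1) * ⟪w, t.nrm (t.vtx 0, t.vtx 1)⟫)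
      + q (emid (t.vtx 1, t.vtx 2)) * (elen (t.vtx 1, t.vtx 2) * ⟪w, t.nrm (t.vtx 1, t.vtx 2)⟫)
      + q (emid (t.vtx 2, t.vtx 0)) * (elen (t.vtx 2, t.vtx 0) * ⟪w, t.nrm (t.vtx 2, t.vtx 0)⟫)) := by
  obtain ⟨s, hs, h1, h2, h3⟩ := t.nrm3
  simp only [← real_inner_smul_right, h1, h2, h3]
  rw [t.area_eq, hs, affine_eval q (emid _), affine_eval q (emid (_, _)),
    affine_eval q (emid (t.vtx 2, t.vtx 0)), Tri.D, cr_eq]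
  simp only [emid, midpoint_eq_smul_add, PiLp.inner_apply, Fin.sum_univ_two, perp0, perp1,
    PiLp.smul_apply, PiLp.add_apply, PiLp.sub_apply, smul_eq_mul, RCLike.inner_apply, conj_trivial,
    invOf_eq_inv]
  ring

lemma Tri.closed (t : Tri) (w : E2) :
      (elen (t.vtx 0, t.vtx 1) * ⟪w, t.nrm (t.vtx 0, t.vtx 1)⟫)
      + (elen (t.vtx 1, t.vtx 2) * ⟪w, t.nrm (t.vtx 1, t.vtx 2)⟫)
      + (elen (t.vtx 2, t.vtx 0) * ⟪w, t.nrm (t.vtx 2, t.vtx 0)⟫) = 0 := by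
  obtain ⟨s, hs, h1, h2, h3⟩ := t.nrm3
  simp only [← real_inner_smul_right, h1, h2, h3]
  simp only [PiLp.inner_apply, Fin.sum_univ_two, perp0, perp1,
    PiLp.smul_apply, PiLp.sub_apply, smul_eq_mul, RCLike.inner_apply, conj_trivial]
  ring

lemma elen_swap (σ : E2 × E2) : elen σ.swap = elen σ := by simp [elen, dist_comm]

lemma emid_swap (σ : E2 × E2) : emid σ.swap = emid σ := by simp [emid, midpoint_comm]

namespace Mesh

variable {Ω : Set E2} (M : Mesh Ω)

lemma sum_edges (t : Tri) (ht : t ∈ M.tris) (F : E2 × E2 → ℝ)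
    (hF : ∀ σ, t.hasEdge σ → F σ.swap = F σ) :
    ∑ σ ∈ M.edges.filter (fun σ => t.hasEdge σ), F σ =
      F (t.vtx 0, t.vtx 1) + F (t.vtx 1, t.vtx 2) + F (t.vtx 2, t.vtx 0) := by
  have hinj := t.indep.injective
  have edge : ∀ i j : Fin 3, i ≠ j → t.hasEdge (t.vtx i, t.vtx j) := fun i j h =>
    ⟨hinj.ne h, ⟨i, rfl⟩, ⟨j, rfl⟩⟩
  have pick : ∀ i j : Fin 3, i ≠ j → ∃ σ ∈ M.edges, (σ = (t.vtx i, t.vtx j) ∨ σ = (t.vtx j, t.vtx i))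
      ∧ (∀ τ ∈ M.edges, (τ = (t.vtx i, t.vtx j) ∨ τ = (t.vtx j, t.vtx i)) → τ = σ)
      ∧ t.hasEdge σ ∧ F σ = F (t.vtx i, t.vtx j) := by
    intro i j hij
    rcases M.edges_cover t ht i j hij with h | h
    · refine ⟨_, h, Or.inl rfl, ?_, edge i j hij, rfl⟩
      rintro τ hτ (rfl | rfl)
      · rfl
      · exact absurd hτ (M.edges_orient _ h)
    · refine ⟨_, h, Or.inr rfl, ?_, edge j i hij.symm, (hF _ (edge i j hij))⟩
      rintro τ hτ (rfl | rfl)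
      · exact absurd hτ (M.edges_orient _ h)
      · rfl
  obtain ⟨a, ha, ha', hau, hae, haF⟩ := pick 0 1 (by decide)
  obtain ⟨b, hb, hb', hbu, hbe, hbF⟩ := pick 1 2 (by decide)
  obtain ⟨c, hc, hc', hcu, hce, hcF⟩ := pick 2 0 (by decide)
  have i01 : t.vtx 0 ≠ t.vtx 1 := hinj.ne (by decide)
  have i12 : t.vtx 1 ≠ t.vtx 2 := hinj.ne (by decide)
  have i20 : t.vtx 2 ≠ t.vtx 0 := hinj.ne (by decide)
  have hab : a ≠ b := by
    rcases ha' with rfl | rfl <;> rcases hb' with rfl | rfl <;>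
      simp [Prod.ext_iff, i01, i12, i20, i01.symm, i12.symm, i20.symm]
  have hac : a ≠ c := by
    rcases ha' with rfl | rfl <;> rcases hc' with rfl | rfl <;>
      simp [Prod.ext_iff, i01, i12, i20, i01.symm, i12.symm, i20.symm]
  have hbc : b ≠ c := by
    rcases hb' with rfl | rfl <;> rcases hc' with rfl | rfl <;>
      simp [Prod.ext_iff, i01, i12, i20, i01.symm, i12.symm, i20.symm]
  have hset : M.edges.filter (fun σ => t.hasEdge σ) = {a, b, c} := by
    ext σ
    simp only [Finset.mem_filter, Finset.mem_insert, Finset.mem_singleton]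
    constructor
    · rintro ⟨hσ, hne, ⟨i, hi⟩, ⟨j, hj⟩⟩
      have hs : σ = (t.vtx i, t.vtx j) := by rw [hi, hj]
      clear hi hj
      have hij : i ≠ j := by rintro rfl; rw [hs] at hne; exact hne rfl
      fin_cases i <;> fin_cases j <;> first
        | exact absurd rfl hij
        | exact Or.inl (hau σ hσ (Or.inl hs))
        | exact Or.inl (hau σ hσ (Or.inr hs))
        | exact Or.inr (Or.inl (hbu σ hσ (Or.inl hs)))
        | exact Or.inr (Or.inl (hbu σ hσ (Or.inr hs)))
        | exact Or.inr (Or.inr (hcu σ hσ (Or.inl hs)))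
        | exact Or.inr (Or.inr (hcu σ hσ (Or.inr hs)))
    · rintro (rfl | rfl | rfl)
      · exact ⟨ha, hae⟩
      · exact ⟨hb, hbe⟩
      · exact ⟨hc, hce⟩
  rw [hset, Finset.sum_insert (by simp [hab, hac]), Finset.sum_insert (by simp [hbc]),
    Finset.sum_singleton, haF, hbF, hcF, add_assoc]

lemma filter_int (σ : E2 × E2) (h : σ ∈ M.intEdges) :
    M.tris.filter (fun t => t.hasEdge σ) = {M.Kof σ, M.Lof σ} ∧ M.Lof σ ≠ M.Kof σ := by
  obtain ⟨he, hc⟩ := Finset.mem_filter.mp h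
  obtain ⟨k1, k2⟩ := M.Kof_mem σ he
  obtain ⟨l1, l2, l3⟩ := M.Lof_mem σ he hc
  refine ⟨(Finset.eq_of_subset_of_card_le ?_ ?_).symm, l3⟩
  · intro x hx
    rcases Finset.mem_insert.mp hx with rfl | hx
    · exact Finset.mem_filter.mpr ⟨k1, k2⟩
    · rw [Finset.mem_singleton.mp hx]; exact Finset.mem_filter.mpr ⟨l1, l2⟩
  · rw [hc, Finset.card_pair l3.symm]

lemma filter_ext (σ : E2 × E2) (h : σ ∈ M.extEdges) :
    M.tris.filter (fun t => t.hasEdge σ) = {M.Kof σ} := by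
  obtain ⟨he, hc⟩ := Finset.mem_filter.mp h
  obtain ⟨k1, k2⟩ := M.Kof_mem σ he
  refine (Finset.eq_of_subset_of_card_le ?_ ?_).symm
  · intro x hx
    rw [Finset.mem_singleton.mp hx]; exact Finset.mem_filter.mpr ⟨k1, k2⟩
  · rw [hc, Finset.card_singleton]

lemma sum_comm_filter (S : Finset (E2 × E2)) (F : Tri → E2 × E2 → ℝ) :
    ∑ t ∈ M.tris, ∑ σ ∈ S.filter (fun σ => t.hasEdge σ), F t σ =
      ∑ σ ∈ S, ∑ t ∈ M.tris.filter (fun t => t.hasEdge σ), F t σ := by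
  apply Finset.sum_comm'
  intro x y
  simp only [Finset.mem_filter]
  tauto

lemma sum_int (F : Tri → E2 × E2 → ℝ) :
    ∑ t ∈ M.tris, ∑ σ ∈ M.intEdges.filter (fun σ => t.hasEdge σ), F t σ =
      ∑ σ ∈ M.intEdges, (F (M.Kof σ) σ + F (M.Lof σ) σ) := by
  rw [sum_comm_filter]
  refine Finset.sum_congr rfl fun σ hσ => ?_
  obtain ⟨h1, h2⟩ := M.filter_int σ hσ
  rw [h1, Finset.sum_pair h2.symm]

lemma sum_ext (F : Tri → E2 × E2 → ℝ) :
    ∑ t ∈ M.tris, ∑ σ ∈ M.extEdges.filter (fun σ => t.hasEdge σ), F t σ =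
      ∑ σ ∈ M.extEdges, F (M.Kof σ) σ := by
  rw [sum_comm_filter]
  refine Finset.sum_congr rfl fun σ hσ => ?_
  rw [M.filter_ext σ hσ, Finset.sum_singleton]

lemma edges_cases (σ : E2 × E2) (h : σ ∈ M.edges) :
    σ ∈ M.intEdges ∨ (σ ∈ M.extEdges ∧ σ ∉ M.intEdges) := by
  have h1 := M.edges_atMostTwo σ h
  obtain ⟨t, ht, he⟩ := M.edges_sub σ h
  have h2 : 0 < (M.tris.filter fun t => t.hasEdge σ).card :=
    Finset.card_pos.mpr ⟨t, Finset.mem_filter.mpr ⟨ht, he⟩⟩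
  simp only [intEdges, extEdges, Finset.mem_filter, h, true_and]
  omega

lemma sum_split (P : E2 × E2 → Prop) (F : E2 × E2 → ℝ) :
    ∑ σ ∈ M.edges.filter P, F σ = ∑ σ ∈ M.intEdges.filter P, F σ + ∑ σ ∈ M.extEdges.filter P, F σ := by
  rw [← Finset.sum_union]
  · refine Finset.sum_congr ?_ fun _ _ => rfl
    ext σ
    simp only [Finset.mem_filter, Finset.mem_union]
    constructor
    · rintro ⟨h1, h2⟩
      rcases M.edges_cases σ h1 with h | h
      · exact Or.inl ⟨h, h2⟩
      · exact Or.inr ⟨h.1, h2⟩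
    · rintro (⟨h1, h2⟩ | ⟨h1, h2⟩)
      · exact ⟨(Finset.mem_filter.mp h1).1, h2⟩
      · exact ⟨(Finset.mem_filter.mp h1).1, h2⟩
  · rw [Finset.disjoint_left]
    intro σ h1 h2
    have a := (Finset.mem_filter.mp (Finset.mem_filter.mp h1).1).2
    have b := (Finset.mem_filter.mp (Finset.mem_filter.mp h2).1).2
    omega

lemma opp (σ : E2 × E2) (h : σ ∈ M.intEdges) :
    (M.Lof σ).nrm σ = - (M.Kof σ).nrm σ := by
  obtain ⟨he, hc⟩ := Finset.mem_filter.mp h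
  obtain ⟨k1, k2⟩ := M.Kof_mem σ he
  obtain ⟨l1, l2, l3⟩ := M.Lof_mem σ he hc
  exact nrm_opp _ _ σ k2 l2 (M.interior_disjoint _ k1 _ l1 l3.symm)

lemma orth (v : Tri → E2) (hv : M.IsRT0const v) (q : Tri → (E2 →ᵃ[ℝ] ℝ)) (hq : M.IsP1nc q) :
    M.l2P0 v (gradh q) = 0 := by
  have h1 : M.l2P0 v (gradh q) = 2 * cstd * ∑ t ∈ M.tris,
      ∑ σ ∈ M.edges.filter (fun σ => t.hasEdge σ),
        q t (emid σ) * (elen σ * ⟪v t, t.nrm σ⟫) := by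
    rw [l2P0, Finset.mul_sum]
    refine Finset.sum_congr rfl fun t ht => ?_
    rw [M.sum_edges t ht]
    · exact t.green (q t) (v t)
    · intro σ hσ
      rw [emid_swap, elen_swap, t.nrm_swap σ hσ]
  rw [h1]
  simp only [M.sum_split]
  rw [Finset.sum_add_distrib, M.sum_int, M.sum_ext, Finset.sum_eq_zero, Finset.sum_eq_zero]
  · ring
  · intro σ hσ
    rw [hv.2 σ hσ]; ring
  · intro σ hσ
    have := hv.1 σ hσ
    rw [inner_sub_left] at this
    rw [M.opp σ hσ, inner_neg_right, ← hq σ hσ]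
    linear_combination (-q (M.Kof σ) (emid σ) * elen σ) * this

lemma other_K (σ : E2 × E2) : M.other (M.Kof σ) σ = M.Lof σ := by simp [other]

lemma other_L (σ : E2 × E2) (h : σ ∈ M.intEdges) : M.other (M.Lof σ) σ = M.Kof σ := by
  rw [other, if_neg (M.filter_int σ h).2.symm]

lemma lap (v : Tri → E2) : ∑ t ∈ M.tris, t.area * ⟪M.laph v t, v t⟫ = - (M.normh v) ^ 2 := by
  have htau : ∀ σ, 0 ≤ M.tau σ := by
    intro σ
    refine div_nonneg dist_nonneg ?_
    rw [dOf]; split_ifs <;> exact dist_nonneg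
  rw [normh, Real.sq_sqrt (add_nonneg
    (Finset.sum_nonneg fun σ _ => mul_nonneg (htau σ) (sq_nonneg _))
    (Finset.sum_nonneg fun σ _ => mul_nonneg (htau σ) (sq_nonneg _)))]
  have h1 : ∀ t ∈ M.tris, t.area * ⟪M.laph v t, v t⟫ =
      ∑ σ ∈ M.intEdges.filter (fun σ => t.hasEdge σ), M.tau σ * ⟪v (M.other t σ) - v t, v t⟫
      - ∑ σ ∈ M.extEdges.filter (fun σ => t.hasEdge σ), M.tau σ * ⟪v t, v t⟫ := by
    intro t _
    rw [laph, real_inner_smul_left, ← mul_assoc, mul_inv_cancel₀ t.area_pos.ne', one_mul,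
      inner_sub_left, sum_inner, sum_inner]
    simp only [real_inner_smul_left]
  rw [Finset.sum_congr rfl h1, Finset.sum_sub_distrib,
    M.sum_int (fun t σ => M.tau σ * ⟪v (M.other t σ) - v t, v t⟫),
    M.sum_ext (fun t σ => M.tau σ * ⟪v t, v t⟫), neg_add, ← sub_eq_add_neg, ← Finset.sum_neg_distrib]
  congr 1
  · refine Finset.sum_congr rfl fun σ hσ => ?_
    rw [M.other_K, M.other_L σ hσ, ← real_inner_self_eq_norm_sq]
    simp only [inner_sub_left, inner_sub_right]
    rw [real_inner_comm (v (M.Lof σ)) (v (M.Kof σ))]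
    ring
  · refine Finset.sum_congr rfl fun σ hσ => ?_
    rw [real_inner_self_eq_norm_sq]

lemma conv (w v : Tri → E2) (hw : M.IsRT0const w) :
    0 ≤ ∑ t ∈ M.tris, t.area * ⟪M.btilde (fun s => AffineMap.const ℝ E2 (w s)) v t, v t⟫ := by
  have hu : ∀ t σ, unrm (fun s => AffineMap.const ℝ E2 (w s)) t σ = ⟪w t, t.nrm σ⟫ := by
    intro t σ; simp [unrm]
  have h1 : ∀ t ∈ M.tris,
      t.area * ⟪M.btilde (fun s => AffineMap.const ℝ E2 (w s)) v t, v t⟫ =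
      ∑ σ ∈ M.intEdges.filter (fun σ => t.hasEdge σ), elen σ *
        (max ⟪w t, t.nrm σ⟫ 0 * ⟪v t, v t⟫ + min ⟪w t, t.nrm σ⟫ 0 * ⟪v (M.other t σ), v t⟫) := by
    intro t _
    rw [btilde, real_inner_smul_left, ← mul_assoc, mul_inv_cancel₀ t.area_pos.ne', one_mul,
      sum_inner]
    simp only [real_inner_smul_left, inner_add_left, hu]
  -- the discrete divergence of w vanishes
  have h0 : ∑ t ∈ M.tris, ∑ σ ∈ M.edges.filter (fun σ => t.hasEdge σ),
      (elen σ * ⟪w t, t.nrm σ⟫) * ⟪v t, v t⟫ = 0 := by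
    refine Finset.sum_eq_zero fun t ht => ?_
    rw [← Finset.sum_mul, M.sum_edges t ht, t.closed, zero_mul]
    intro σ hσ
    rw [elen_swap, t.nrm_swap σ hσ]
  simp only [M.sum_split] at h0
  rw [Finset.sum_add_distrib, M.sum_int, M.sum_ext,
    Finset.sum_eq_zero (s := M.extEdges) (fun σ hσ => by rw [hw.2 σ hσ]; ring), add_zero] at h0
  rw [Finset.sum_congr rfl h1,
    M.sum_int (fun t σ => elen σ *
      (max ⟪w t, t.nrm σ⟫ 0 * ⟪v t, v t⟫ + min ⟪w t, t.nrm σ⟫ 0 * ⟪v (M.other t σ), v t⟫))]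
  have h2 : 0 = ∑ σ ∈ M.intEdges, (1/2) * (elen σ * ⟪w (M.Kof σ), (M.Kof σ).nrm σ⟫ * ⟪v (M.Kof σ), v (M.Kof σ)⟫ + elen σ * ⟪w (M.Lof σ), (M.Lof σ).nrm σ⟫ * ⟪v (M.Lof σ), v (M.Lof σ)⟫) := by
    rw [← Finset.mul_sum, h0, mul_zero]
  refine h2.le.trans ?_
  refine Finset.sum_le_sum fun σ hσ => ?_
  rw [M.other_K, M.other_L σ hσ, M.opp σ hσ, inner_neg_right]
  have hh := hw.1 σ hσ
  rw [inner_sub_left, sub_eq_zero] at hh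
  rw [hh]
  set a := ⟪w (M.Kof σ), (M.Kof σ).nrm σ⟫
  have hl : 0 ≤ elen σ := dist_nonneg
  have hn : 0 ≤ ⟪v (M.Kof σ) - v (M.Lof σ), v (M.Kof σ) - v (M.Lof σ)⟫ := real_inner_self_nonneg
  simp only [inner_sub_left, inner_sub_right] at hn
  have hc := real_inner_comm (v (M.Lof σ)) (v (M.Kof σ))
  rw [hc] at hn
  rw [hc]
  rcases le_total 0 a with ha | ha
  · rw [max_eq_left ha, min_eq_right ha, max_eq_right (by linarith : -a ≤ 0),
      min_eq_left (by linarith : -a ≤ 0)]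
    nlinarith [mul_nonneg (mul_nonneg hl ha) hn]
  · rw [max_eq_right ha, min_eq_left ha, max_eq_left (by linarith : 0 ≤ -a),
      min_eq_right (by linarith : 0 ≤ -a)]
    nlinarith [mul_nonneg (mul_nonneg hl (neg_nonneg.mpr ha)) hn]

lemma rt_of_div (v : Tri → E2) (h : ∀ σ ∈ M.edges, M.divhImage v σ = 0) : M.IsRT0const v := by
  constructor
  · intro σ hσ
    obtain ⟨he, hc⟩ := Finset.mem_filter.mp hσ
    have := h σ he
    rw [divhImage, if_pos hc] at this
    have hp : 0 < 3 * elen σ / ((M.Kof σ).area + (M.Lof σ).area) :=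
      div_pos (by have := elen_pos σ (M.edges_ne σ he); linarith)
        (add_pos (Tri.area_pos _) (Tri.area_pos _))
    exact (mul_eq_zero.mp this).resolve_left hp.ne'
  · intro σ hσ
    obtain ⟨he, hc⟩ := Finset.mem_filter.mp hσ
    have := h σ he
    rw [divhImage, if_neg (by omega), neg_eq_zero] at this
    have hp : 0 < 3 * elen σ / (M.Kof σ).area :=
      div_pos (by have := elen_pos σ (M.edges_ne σ he); linarith) (Tri.area_pos _)
    exact (mul_eq_zero.mp this).resolve_left hp.ne'

lemma div_lin (u v g : Tri → E2) (c : ℝ) (h : ∀ t ∈ M.tris, u t = v t - c • g t) :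
    ∀ σ ∈ M.edges, M.divhImage u σ = M.divhImage v σ - c * M.divhImage g σ := by
  intro σ he
  obtain ⟨k1, k2⟩ := M.Kof_mem σ he
  rw [divhImage, divhImage, divhImage]
  split_ifs with hc
  · obtain ⟨l1, l2, l3⟩ := M.Lof_mem σ he hc
    rw [h _ k1, h _ l1]
    simp only [inner_sub_left, real_inner_smul_left]
    ring
  · rw [h _ k1]
    simp only [inner_sub_left, real_inner_smul_left]
    ring

lemma rt_comb (u v : Tri → E2) (hu : M.IsRT0const u) (hv : M.IsRT0const v) (c : ℝ) :
    M.IsRT0const (fun t => c • u t - v t) := by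
  constructor
  · intro σ hσ
    have h1 := hu.1 σ hσ
    have h2 := hv.1 σ hσ
    simp only [inner_sub_left, real_inner_smul_left] at *
    linear_combination c * h1 - h2
  · intro σ hσ
    have h1 := hu.2 σ hσ
    have h2 := hv.2 σ hσ
    simp only [inner_sub_left, real_inner_smul_left] at *
    linear_combination c * h1 - h2

/-- Isometric embedding of `P₀` in a Hilbert space. -/
def emb (v : Tri → E2) : PiLp 2 (fun _ : M.tris => E2) :=
  WithLp.toLp 2 (fun t => Real.sqrt (t.1.area) • v t.1)

lemma emb_inner (v w : Tri → E2) : ⟪M.emb v, M.emb w⟫ = M.l2P0 v w := by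
  rw [PiLp.inner_apply, l2P0, ← Finset.sum_coe_sort M.tris]
  refine Finset.sum_congr rfl fun t _ => ?_
  simp only [emb, real_inner_smul_left, real_inner_smul_right]
  rw [← mul_assoc, Real.mul_self_sqrt t.1.area_pos.le]

lemma emb_norm (v : Tri → E2) : ‖M.emb v‖ = M.l2normP0 v := by
  rw [l2normP0, ← emb_inner, real_inner_self_eq_norm_sq, Real.sqrt_sq (norm_nonneg _)]

end Mesh

lemma Scheme.rt {Ω : Set E2} {M : Mesh Ω} (S : Scheme M) :
    ∀ n ≤ S.N, M.IsRT0const (S.u n) := by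
  have hN : (0:ℝ) < S.N := by exact_mod_cast (by have := S.hN; omega : 0 < S.N)
  have hk : 0 < S.k := by rw [S.hk]; exact div_pos S.hT hN
  intro n hn
  match n, hn with
  | 0, _ => exact S.hu0
  | 1, _ => exact S.hu1
  | n + 2, hn =>
    apply M.rt_of_div
    intro σ hσ
    rw [M.div_lin _ _ _ _ (S.corr (n+1) (by omega) hn) σ hσ, S.proj (n+1) (by omega) hn σ hσ]
    field_simp
    ring

lemma Scheme.step {Ω : Set E2} {M : Mesh Ω} (S : Scheme M) (n : ℕ) (h1 : 1 ≤ n)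
    (h2 : n + 1 ≤ S.N) :
    ⟪(3 : ℝ) • M.emb (S.ut (n+1)) - (4 : ℝ) • M.emb (S.u n) + M.emb (S.u (n-1)),
        M.emb (S.ut (n+1))⟫
      + 2 * S.k * S.Re⁻¹ * (M.normh (S.ut (n+1))) ^ 2
      + 2 * S.k * ⟪M.emb (gradh (S.p n)), M.emb (S.ut (n+1))⟫
      ≤ 2 * S.k * ⟪M.emb (S.fh (n+1)), M.emb (S.ut (n+1))⟫ := by
  have hN : (0:ℝ) < S.N := by exact_mod_cast (by have := S.hN; omega : 0 < S.N)
  have hk : 0 < S.k := by rw [S.hk]; exact div_pos S.hT hN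
  have hc := M.conv _ (S.ut (n+1))
    (M.rt_comb _ _ (S.rt n (by omega)) (S.rt (n-1) (by omega)) 2)
  have hl := M.lap (S.ut (n+1))
  have key : M.l2P0 (S.fh (n+1)) (S.ut (n+1)) =
      (2 * S.k)⁻¹ * (3 * M.l2P0 (S.ut (n+1)) (S.ut (n+1)) - 4 * M.l2P0 (S.u n) (S.ut (n+1))
        + M.l2P0 (S.u (n-1)) (S.ut (n+1)))
      - S.Re⁻¹ * (∑ t ∈ M.tris, t.area * ⟪M.laph (S.ut (n+1)) t, S.ut (n+1) t⟫)
      + (∑ t ∈ M.tris, t.area * ⟪M.btilde (fun s => AffineMap.const ℝ E2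
          ((2 : ℝ) • S.u n s - S.u (n-1) s)) (S.ut (n+1)) t, S.ut (n+1) t⟫)
      + M.l2P0 (gradh (S.p n)) (S.ut (n+1)) := by
    simp only [Mesh.l2P0, Finset.mul_sum, ← Finset.sum_add_distrib, ← Finset.sum_sub_distrib]
    refine Finset.sum_congr rfl fun t ht => ?_
    rw [← S.mom n h1 h2 t ht]
    simp only [inner_add_left, inner_sub_left, real_inner_smul_left]
    ring
  simp only [inner_add_left, inner_sub_left, real_inner_smul_left, Mesh.emb_inner]
  rw [key, hl]
  have : 2 * S.k * ((2 * S.k)⁻¹ * (3 * M.l2P0 (S.ut (n+1)) (S.ut (n+1))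
        - 4 * M.l2P0 (S.u n) (S.ut (n+1)) + M.l2P0 (S.u (n-1)) (S.ut (n+1)))) =
      3 * M.l2P0 (S.ut (n+1)) (S.ut (n+1)) - 4 * M.l2P0 (S.u n) (S.ut (n+1))
        + M.l2P0 (S.u (n-1)) (S.ut (n+1)) := by
    rw [← mul_assoc, mul_inv_cancel₀ (by positivity), one_mul]
  have h3 := mul_nonneg hk.le hc
  nlinarith [this, h3]

lemma energy_step {H : Type*} [NormedAddCommGroup H] [InnerProductSpace ℝ H]
    (k r a : ℝ) (hk : 0 < k) (Cf : ℝ)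
    (u0 u1 u2 ut g1 g2 f : H) (hf : ‖f‖ ≤ Cf)
    (hcorr : u2 = ut - (2 * k / 3) • (g2 - g1))
    (o01 : ⟪u0, g1⟫ = 0) (o02 : ⟪u0, g2⟫ = 0) (o11 : ⟪u1, g1⟫ = 0) (o12 : ⟪u1, g2⟫ = 0)
    (o21 : ⟪u2, g1⟫ = 0) (o22 : ⟪u2, g2⟫ = 0)
    (hm : ⟪(3 : ℝ) • ut - (4 : ℝ) • u1 + u0, ut⟫ + 2 * k * r * a + 2 * k * ⟪g1, ut⟫
      ≤ 2 * k * ⟪f, ut⟫) :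
    (‖u2‖ ^ 2 + ‖(2 : ℝ) • u2 - u1‖ ^ 2 + 4 * k ^ 2 / 3 * ‖g2‖ ^ 2) + 4 * k * r * a
      ≤ (‖u1‖ ^ 2 + ‖(2 : ℝ) • u1 - u0‖ ^ 2 + 4 * k ^ 2 / 3 * ‖g1‖ ^ 2)
        + 4 * k * Cf * ‖u2‖ + 4 / 3 * k ^ 2 * Cf ^ 2 := by
  set d : H := g2 - g1 with hd
  have hut : ut = u2 + (2 * k / 3) • d := by rw [hcorr]; abel
  have hfu : ⟪f, u2⟫ ≤ Cf * ‖u2‖ :=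
    (real_inner_le_norm _ _).trans (mul_le_mul_of_nonneg_right hf (norm_nonneg _))
  have hfd : ⟪f, d⟫ ≤ Cf * ‖d‖ :=
    (real_inner_le_norm _ _).trans (mul_le_mul_of_nonneg_right hf (norm_nonneg _))
  have hdd : ‖d‖ ^ 2 = ⟪g2, g2⟫ - 2 * ⟪g1, g2⟫ + ⟪g1, g1⟫ := by
    rw [← real_inner_self_eq_norm_sq, hd]
    simp only [inner_sub_left, inner_sub_right, real_inner_comm g1 g2]; ring
  have hs : 0 ≤ ‖u2 - (2 : ℝ) • u1 + u0‖ ^ 2 := by positivity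
  rw [hut] at hm
  have hsq : 0 ≤ (Cf - ‖d‖) ^ 2 := sq_nonneg _
  have hk1 : 2 * k * (2 * k / 3) * ⟪f, d⟫ ≤ 2 * k * (2 * k / 3) * (Cf * ‖d‖) :=
    mul_le_mul_of_nonneg_left hfd (by positivity)
  have hk2 : 2 * k * ⟪f, u2⟫ ≤ 2 * k * (Cf * ‖u2‖) :=
    mul_le_mul_of_nonneg_left hfu (by positivity)
  have hk3 : 0 ≤ k ^ 2 * (Cf - ‖d‖) ^ 2 := by positivity
  have hk4 : k ^ 2 * ‖d‖ ^ 2 = k ^ 2 * (⟪g2, g2⟫ - 2 * ⟪g1, g2⟫ + ⟪g1, g1⟫) := by rw [hdd]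
  have e1 : ⟪u2, d⟫ = 0 := by rw [hd, inner_sub_right, o21, o22]; ring
  have e2 : ⟪u1, d⟫ = 0 := by rw [hd, inner_sub_right, o11, o12]; ring
  have e3 : ⟪u0, d⟫ = 0 := by rw [hd, inner_sub_right, o01, o02]; ring
  have e4 : ⟪g1, u2⟫ = 0 := by rw [real_inner_comm, o21]
  have e5 : ⟪d, u2⟫ = 0 := by rw [real_inner_comm, e1]
  have e6 : ⟪g1, d⟫ = ⟪g1, g2⟫ - ⟪g1, g1⟫ := by rw [hd, inner_sub_right]
  have hs2 : 0 ≤ k ^ 2 * ‖d‖ ^ 2 := by positivity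
  simp only [inner_add_left, inner_sub_left, inner_add_right,
    real_inner_smul_left, real_inner_smul_right, e1, e2, e3, e4, e5, e6] at hm
  simp only [← real_inner_self_eq_norm_sq, inner_add_left, inner_sub_left, inner_add_right,
    inner_sub_right, real_inner_smul_left, real_inner_smul_right] at hs ⊢
  rw [real_inner_self_eq_norm_sq d] at hm
  have c3 : ⟪u2, u0⟫ = ⟪u0, u2⟫ := real_inner_comm _ _
  have c1 : ⟪u2, u1⟫ = ⟪u1, u2⟫ := real_inner_comm _ _
  have c2 : ⟪u1, u0⟫ = ⟪u0, u1⟫ := real_inner_comm _ _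
  nlinarith [c1, c2, c3, hm, hs, hk1, hk2, hk3, hk4, hs2]

lemma energy_total (E a : ℕ → ℝ) (x : ℕ → ℝ) (k r Cf B0 T : ℝ) (N : ℕ) (hk : 0 < k) (hr : 0 < r)
    (hCf : 0 ≤ Cf) (hB0 : 0 ≤ B0) (hkN : k * N = T) (hE : ∀ n, 0 ≤ E n) (ha : ∀ n, 0 ≤ a n)
    (hxE : ∀ n, x n ^ 2 ≤ E n) (hE1 : E 1 ≤ B0 ^ 2)
    (step : ∀ n, 1 ≤ n → n + 1 ≤ N →
      E (n+1) + 4 * k * r * a (n+1) ≤ E n + 4 * k * Cf * x (n+1) + 4 / 3 * k ^ 2 * Cf ^ 2) :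
    ∀ m, 1 ≤ m → m ≤ N → E m + 4 * r * (k * ∑ n ∈ Finset.Icc 2 m, a n)
      ≤ B0 ^ 2 + 4 * T * Cf * (B0 + 5 * T * Cf) + 4 / 3 * T ^ 2 * Cf ^ 2 := by
  have hsq : ∀ m, 1 ≤ m → m ≤ N → √(E m) ≤ B0 + 5 * (k * m) * Cf := by
    intro m hm
    induction m, hm using Nat.le_induction with
    | base =>
      intro _
      have : √(E 1) ≤ B0 := by
        rw [show B0 = √(B0 ^ 2) from (Real.sqrt_sq hB0).symm]
        exact Real.sqrt_le_sqrt hE1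
      have h5 : 0 ≤ 5 * (k * ((1:ℕ):ℝ)) * Cf := by positivity
      linarith
    | succ n hn ih =>
      intro hN
      have ih := ih (by omega)
      have hs := step n hn hN
      have h1 := Real.sq_sqrt (hE (n+1))
      have h2 := Real.sq_sqrt (hE n)
      have h3 := Real.sqrt_nonneg (E (n+1))
      have h4 := Real.sqrt_nonneg (E n)
      have hx1 : x (n+1) ≤ √(E (n+1)) := Real.le_sqrt_of_sq_le (hxE _)
      have hkc : 0 ≤ k * Cf := by positivity
      have hx2 : 4 * k * Cf * x (n+1) ≤ 4 * k * Cf * √(E (n+1)) :=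
        mul_le_mul_of_nonneg_left hx1 (by positivity)
      have h5 : 0 ≤ 4 * k * r * a (n+1) := mul_nonneg (by positivity) (ha _)
      have key : (√(E (n+1)) - 2 * (k * Cf)) ^ 2 ≤ (√(E n) + 3 * (k * Cf)) ^ 2 := by
        nlinarith [mul_nonneg h4 hkc, mul_nonneg hkc hkc]
      have := abs_le_of_sq_le_sq' key (by positivity)
      push_cast
      nlinarith [this.2]
  have hT : 0 ≤ T := by rw [← hkN]; positivity
  have hsq' : ∀ m, 1 ≤ m → m ≤ N → x m ≤ B0 + 5 * T * Cf := by
    intro m hm hN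
    have h1 : x m ≤ √(E m) := Real.le_sqrt_of_sq_le (hxE _)
    have h2 := hsq m hm hN
    have h3 : k * m ≤ T := by rw [← hkN]; gcongr
    have : 5 * (k * m) * Cf ≤ 5 * T * Cf := by gcongr
    linarith
  have hsum : ∀ m, 1 ≤ m → m ≤ N → E m + 4 * r * (k * ∑ n ∈ Finset.Icc 2 m, a n)
      ≤ B0 ^ 2 + 4 * (k * m) * Cf * (B0 + 5 * T * Cf) + 4 / 3 * (k * m) * T * Cf ^ 2 := by
    intro m hm
    induction m, hm using Nat.le_induction with
    | base =>
      intro _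
      simp only [show Finset.Icc 2 1 = ∅ from rfl, Finset.sum_empty, mul_zero, add_zero]
      refine hE1.trans ?_
      rw [add_assoc]
      refine le_add_of_nonneg_right ?_
      positivity
    | succ n hn ih =>
      intro hN
      have ih := ih (by omega)
      have hs := step n hn hN
      rw [Finset.sum_Icc_succ_top (by omega)]
      have hxx : 4 * k * Cf * x (n+1) ≤ 4 * k * Cf * (B0 + 5 * T * Cf) :=
        mul_le_mul_of_nonneg_left (hsq' (n+1) (by omega) hN) (by positivity)
      have hkT : k ≤ T := by
        rw [← hkN]
        have : (1:ℝ) ≤ N := by exact_mod_cast (by omega : 1 ≤ N)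
        nlinarith
      have hkk : 4 / 3 * k ^ 2 * Cf ^ 2 ≤ 4 / 3 * k * T * Cf ^ 2 := by
        have : k ^ 2 ≤ k * T := by nlinarith
        have := mul_le_mul_of_nonneg_right this (sq_nonneg Cf)
        linarith
      push_cast
      linarith
  intro m hm hN
  refine (hsum m hm hN).trans ?_
  have h3 : k * m ≤ T := by rw [← hkN]; gcongr
  have h4 : 4 * (k * m) * Cf * (B0 + 5 * T * Cf) ≤ 4 * T * Cf * (B0 + 5 * T * Cf) := by gcongr
  have h5 : 4 / 3 * (k * m) * T * Cf ^ 2 ≤ 4 / 3 * T * T * Cf ^ 2 := by gcongr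
  linarith

/-- **Stability of the scheme (velocity estimate)**: under hypothesis (H1) on the initial
values, there is a constant `C > 0` depending only on `Ω`, `C_reg`, `Re`, `T`, the bound
`Cf` on the discrete force terms and `C₀` (but not on `h`, `k` or `N`) such that
`|u^m_h|² + k ∑_{n=2}^m ‖ũⁿ_h‖_h² ≤ C` for every `m ∈ {2,…,N}`. -/
theorem scheme_velocity_stability
    {Ω : Set E2} (hΩo : IsOpen Ω) (hΩc : IsConnected Ω) (hΩb : Bornology.IsBounded Ω)
    (Creg Re T Cf C0 : ℝ) (hCreg : 0 < Creg) (hRe : 0 < Re) (hT : 0 < T)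
    (hCf : 0 ≤ Cf) (hC0 : 0 ≤ C0) :
    ∃ C > 0, ∀ M : Mesh Ω, M.Regular Creg → ∀ S : Scheme M, S.Re = Re → S.T = T →
      (∀ n ≤ S.N, M.l2normP0 (S.fh n) ≤ Cf) →
      (M.l2normP0 (S.u 0) + M.l2normP0 (S.u 1)
          + S.k * M.l2normP0 (gradh (S.p 1)) ≤ C0) →
      ∀ m, 2 ≤ m → m ≤ S.N →
        (M.l2normP0 (S.u m)) ^ 2
          + S.k * ∑ n ∈ Finset.Icc 2 m, (M.normh (S.ut n)) ^ 2 ≤ C := by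
  set B := 4 * C0 with hB
  set R := B ^ 2 + 4 * T * Cf * (B + 5 * T * Cf) + 4 / 3 * T ^ 2 * Cf ^ 2 with hR
  have hR0 : 0 ≤ R := by positivity
  refine ⟨R + Re / 4 * R + 1, by positivity, ?_⟩
  intro M _ S hSRe hST hf h0 m hm hmN
  have hN : (0:ℝ) < S.N := by exact_mod_cast (by have := S.hN; omega : 0 < S.N)
  have hk : 0 < S.k := by rw [S.hk]; exact div_pos S.hT hN
  have hkN : S.k * S.N = T := by rw [S.hk, hST]; field_simp
  let E : ℕ → ℝ := fun n => ‖M.emb (S.u n)‖ ^ 2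
    + ‖(2 : ℝ) • M.emb (S.u n) - M.emb (S.u (n-1))‖ ^ 2
    + 4 * S.k ^ 2 / 3 * ‖M.emb (gradh (S.p n))‖ ^ 2
  have horth : ∀ i j, i ≤ S.N → 1 ≤ j → j ≤ S.N →
      ⟪M.emb (S.u i), M.emb (gradh (S.p j))⟫ = 0 := by
    intro i j hi hj hj'
    rw [M.emb_inner]
    exact M.orth _ (S.rt i hi) _ (S.hp j hj hj').1
  have hE1 : E 1 ≤ B ^ 2 := by
    simp only [← M.emb_norm] at h0
    have a1 := norm_nonneg (M.emb (S.u 0))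
    have a2 := norm_nonneg (M.emb (S.u 1))
    have a3 : 0 ≤ S.k * ‖M.emb (gradh (S.p 1))‖ := by positivity
    have a4 : ‖(2 : ℝ) • M.emb (S.u 1) - M.emb (S.u 0)‖ ≤ 3 * C0 := by
      refine (norm_sub_le _ _).trans ?_
      rw [norm_smul, Real.norm_of_nonneg (by norm_num : (0:ℝ) ≤ 2)]
      linarith
    have b1 : ‖M.emb (S.u 1)‖ ^ 2 ≤ C0 ^ 2 := pow_le_pow_left₀ a2 (by linarith) 2
    have b2 : ‖(2 : ℝ) • M.emb (S.u 1) - M.emb (S.u 0)‖ ^ 2 ≤ (3 * C0) ^ 2 :=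
      pow_le_pow_left₀ (norm_nonneg _) a4 2
    have b3 : (S.k * ‖M.emb (gradh (S.p 1))‖) ^ 2 ≤ C0 ^ 2 := pow_le_pow_left₀ a3 (by linarith) 2
    change ‖M.emb (S.u 1)‖ ^ 2 + ‖(2 : ℝ) • M.emb (S.u 1) - M.emb (S.u 0)‖ ^ 2
      + 4 * S.k ^ 2 / 3 * ‖M.emb (gradh (S.p 1))‖ ^ 2 ≤ _
    rw [hB]
    nlinarith [sq_nonneg C0]
  have htot := energy_total E (fun n => (M.normh (S.ut n)) ^ 2) (fun n => ‖M.emb (S.u n)‖)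
    S.k Re⁻¹ Cf B T S.N hk (by positivity) hCf (by positivity) hkN (fun n => by positivity)
    (fun n => by positivity)
    (fun n => by
      change _ ≤ _ + _ + _
      rw [add_assoc]
      exact le_add_of_nonneg_right (by positivity)) hE1
    (by
      intro n hn1 hn2
      refine energy_step S.k Re⁻¹ _ hk Cf (M.emb (S.u (n-1))) (M.emb (S.u n)) (M.emb (S.u (n+1)))
        (M.emb (S.ut (n+1))) (M.emb (gradh (S.p n))) (M.emb (gradh (S.p (n+1))))
        (M.emb (S.fh (n+1))) ?_ ?_ ?_ ?_ ?_ ?_ ?_ ?_ ?_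
      · rw [M.emb_norm]; exact hf _ hn2
      · ext1 t
        have := S.corr n hn1 hn2 t.1 t.2
        rw [gradA_sub] at this
        simp only [Mesh.emb, PiLp.sub_apply, PiLp.smul_apply, gradh, this]
        module
      · exact horth _ _ (by omega) (by omega) (by omega)
      · exact horth _ _ (by omega) (by omega) (by omega)
      · exact horth _ _ (by omega) (by omega) (by omega)
      · exact horth _ _ (by omega) (by omega) (by omega)
      · exact horth _ _ (by omega) (by omega) (by omega)
      · exact horth _ _ (by omega) (by omega) (by omega)
      · rw [← hSRe]; exact S.step n hn1 hn2)
    m (by omega) hmN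
  rw [← hR] at htot
  rw [← M.emb_norm]
  set Sg := S.k * ∑ n ∈ Finset.Icc 2 m, (M.normh (S.ut n)) ^ 2 with hSg
  have hSg0 : 0 ≤ Sg := mul_nonneg hk.le (Finset.sum_nonneg fun _ _ => sq_nonneg _)
  have hEm : ‖M.emb (S.u m)‖ ^ 2 ≤ E m := by
    change _ ≤ _ + _ + _
    rw [add_assoc]
    exact le_add_of_nonneg_right (by positivity)
  have hu0 : 0 ≤ ‖M.emb (S.u m)‖ ^ 2 := by positivity
  have hrS : 0 ≤ 4 * Re⁻¹ * Sg := by positivity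
  have c1 : ‖M.emb (S.u m)‖ ^ 2 ≤ R := by linarith
  have c2 : 4 * Re⁻¹ * Sg ≤ R := by linarith
  have c3 : Sg = Re / 4 * (4 * Re⁻¹ * Sg) := by field_simp
  have c4 : Re / 4 * (4 * Re⁻¹ * Sg) ≤ Re / 4 * R := mul_le_mul_of_nonneg_left c2 (by positivity)
  linarith

end
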